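/- Let u : ℝ³ → ℝ be twice continuously differentiable with compact support. Then u is recovered from its Laplacian by the Newtonian potential: for every r ∈ ℝ³, u(r) = −(1/(4π)) ∫_{ℝ³} Δu(r') / ‖r − r'‖ dr'. -/

import Mathlib

open MeasureTheory Real
open scoped RealInnerProductSpace

noncomputable section

/-- Euclidean space ℝ³. -/
abbrev E3 := EuclideanSpace ℝ (Fin 3)

/-- Laplacian of a scalar field: sum of second partial derivatives. -/
def lap (u : E3 → ℝ) (x : E3) : ℝ :=
  ∑ i : Fin 3,
    fderiv ℝ (fun y => fderiv ℝ u y (EuclideanSpace.single i 1)) x (EuclideanSpace.single i 1)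

/-- Divergence of a vector field: sum of partial derivatives of its components. -/
def dvg (v : E3 → E3) (x : E3) : ℝ :=
  ∑ i : Fin 3, fderiv ℝ v x (EuclideanSpace.single i 1) i

/-- The density `z ↦ (3 / 4π) (1 + ‖z‖²)^(-5/2)`, whose rescalings are the Laplacians of the
regularized Newtonian kernels. -/
def newtonBump (z : E3) : ℝ := 3 / (4 * π) * (1 + ‖z‖ ^ 2) ^ (-(5 / 2) : ℝ)

lemma newtonBump_nonneg (z : E3) : 0 ≤ newtonBump z := by
  unfold newtonBump; positivity

lemma integral_Ioi_sq_mul_rpow :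
    ∫ y in Set.Ioi (0 : ℝ), y ^ 2 * (1 + y ^ 2) ^ (-(5 / 2) : ℝ) = 1 / 3 := by
  have hderiv : ∀ y ∈ Set.Ici (0 : ℝ), HasDerivAt
      (fun y : ℝ => y ^ 3 / 3 * (1 + y ^ 2) ^ (-(3 / 2) : ℝ))
      (y ^ 2 * (1 + y ^ 2) ^ (-(5 / 2) : ℝ)) y := by
    intro y _
    have hpos : 0 < 1 + y ^ 2 := by positivity
    have h1 : HasDerivAt (fun y : ℝ => 1 + y ^ 2) (2 * y) y := by
      simpa using ((hasDerivAt_id y).pow 2).const_add 1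
    have h2 : HasDerivAt (fun y : ℝ => y ^ 3 / 3) (y ^ 2) y := by
      have := ((hasDerivAt_id y).pow 3).div_const 3
      convert! this using 1
      simp
    convert! h2.mul (h1.rpow_const (p := (-(3 / 2) : ℝ)) (Or.inl hpos.ne')) using 1
    have e : (1 + y ^ 2) ^ (-(3 / 2) : ℝ) = (1 + y ^ 2) ^ (-(5 / 2) : ℝ) * (1 + y ^ 2) := by
      rw [← rpow_add_one hpos.ne']; norm_num
    have e' : (-(3 / 2) - 1 : ℝ) = -(5 / 2) := by norm_num
    rw [e', e]
    ring
  have hlim : Filter.Tendsto (fun y : ℝ => y ^ 3 / 3 * (1 + y ^ 2) ^ (-(3 / 2) : ℝ))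
      Filter.atTop (nhds (1 / 3)) := by
    have h0 : Filter.Tendsto (fun y : ℝ => 1 + (y ^ 2)⁻¹) Filter.atTop (nhds 1) := by
      simpa using (tendsto_inv_atTop_zero.comp
        (Filter.tendsto_pow_atTop (α := ℝ) two_ne_zero)).const_add 1
    have h1 := (h0.rpow_const (p := (-(3 / 2) : ℝ)) (Or.inl one_ne_zero)).div_const 3
    rw [one_rpow] at h1
    refine h1.congr' ?_
    filter_upwards [Filter.eventually_gt_atTop 0] with y hy
    have e : 1 + y ^ 2 = y ^ 2 * (1 + (y ^ 2)⁻¹) := by field_simp; ring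
    have e2 : (y ^ 2) ^ (-(3 / 2) : ℝ) = (y ^ 3)⁻¹ := by
      rw [← rpow_natCast, ← rpow_mul hy.le, ← rpow_natCast, ← rpow_neg hy.le]
      norm_num
    rw [e, mul_rpow (by positivity) (by positivity), e2]
    field_simp
  rw [integral_Ioi_of_hasDerivAt_of_nonneg' hderiv (fun y _ => by positivity) hlim]
  simp

lemma integral_newtonBump : ∫ z, newtonBump z = 1 := by
  have h := integral_fun_norm_addHaar (volume : Measure E3)
    (fun y : ℝ => (1 + y ^ 2) ^ (-(5 / 2) : ℝ))
  simp only [finrank_euclideanSpace, Fintype.card_fin, smul_eq_mul, nsmul_eq_mul,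
    Nat.add_one_sub_one, integral_Ioi_sq_mul_rpow] at h
  have hv : (volume : Measure E3).real (Metric.ball 0 1) = π * 4 / 3 := by
    rw [Measure.real, InnerProductSpace.volume_ball_of_dim_odd (k := 1) (by simp)]
    simp [Nat.doubleFactorial]
    rw [ENNReal.toReal_ofReal (by positivity)]
    ring
  unfold newtonBump
  rw [integral_const_mul, h, hv]
  field_simp
  norm_num

lemma tendsto_norm_pow_mul_newtonBump :
    Filter.Tendsto (fun z : E3 => ‖z‖ ^ Module.finrank ℝ E3 * newtonBump z)
      (Bornology.cobounded E3) (nhds 0) := by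
  have hlim : Filter.Tendsto (fun z : E3 => 3 / (4 * π) * (‖z‖ ^ 2)⁻¹)
      (Bornology.cobounded E3) (nhds 0) := by
    simpa using ((tendsto_inv_atTop_zero.comp (Filter.tendsto_pow_atTop (α := ℝ) two_ne_zero)).comp
      (tendsto_norm_cobounded_atTop (E := E3))).const_mul (3 / (4 * π))
  refine squeeze_zero' (.of_forall fun z => mul_nonneg (by positivity) (newtonBump_nonneg z)) ?_ hlim
  filter_upwards [(tendsto_norm_cobounded_atTop (E := E3)).eventually_gt_atTop 0] with z hz
  simp only [finrank_euclideanSpace, Fintype.card_fin, newtonBump]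
  have h : (1 + ‖z‖ ^ 2) ^ (-(5 / 2) : ℝ) ≤ (‖z‖ ^ 2) ^ (-(5 / 2) : ℝ) :=
    rpow_le_rpow_of_nonpos (by positivity) (by linarith) (by norm_num)
  have e : (‖z‖ ^ 2) ^ (-(5 / 2) : ℝ) = (‖z‖ ^ 5)⁻¹ := by
    rw [← rpow_natCast, ← rpow_mul hz.le, ← rpow_natCast, ← rpow_neg hz.le]
    norm_num
  rw [e] at h
  calc ‖z‖ ^ 3 * (3 / (4 * π) * (1 + ‖z‖ ^ 2) ^ (-(5 / 2) : ℝ))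
      ≤ ‖z‖ ^ 3 * (3 / (4 * π) * (‖z‖ ^ 5)⁻¹) := by gcongr
    _ = 3 / (4 * π) * (‖z‖ ^ 2)⁻¹ := by field_simp

/-- The regularized Newtonian kernel `c (1 + c² ‖x - r‖²)^(-1/2)`, tending to `1 / ‖x - r‖`
as `c → ∞`. -/
def newtonKernel (c : ℝ) (r x : E3) : ℝ := c * (1 + c ^ 2 * ‖x - r‖ ^ 2) ^ (-(1 / 2) : ℝ)

/-- The partial derivatives of `newtonKernel`. -/
def newtonKernelPartial (c : ℝ) (r : E3) (i : Fin 3) (x : E3) : ℝ :=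
  -c ^ 3 * ((x - r) i * (1 + c ^ 2 * ‖x - r‖ ^ 2) ^ (-(3 / 2) : ℝ))

/-- The pure second partial derivatives of `newtonKernel`. -/
def newtonKernelPartialTwo (c : ℝ) (r : E3) (i : Fin 3) (x : E3) : ℝ :=
  -c ^ 3 * ((1 + c ^ 2 * ‖x - r‖ ^ 2) ^ (-(3 / 2) : ℝ)
    - 3 * c ^ 2 * (x - r) i ^ 2 * (1 + c ^ 2 * ‖x - r‖ ^ 2) ^ (-(5 / 2) : ℝ))

lemma hasLineDerivAt_one_add_rpow (c p : ℝ) (r x : E3) (i : Fin 3) :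
    HasLineDerivAt ℝ (fun x : E3 => (1 + c ^ 2 * ‖x - r‖ ^ 2) ^ p)
      (2 * c ^ 2 * (x - r) i * p * (1 + c ^ 2 * ‖x - r‖ ^ 2) ^ (p - 1)) x
      (EuclideanSpace.single i 1) := by
  have h1 : HasFDerivAt (fun x : E3 => 1 + c ^ 2 * ‖x - r‖ ^ 2)
      (c ^ 2 • (2 • (innerSL ℝ (x - r)).comp (ContinuousLinearMap.id ℝ E3))) x :=
    ((((hasFDerivAt_id x).sub_const r).norm_sq).const_mul (c ^ 2)).const_add 1
  have h2 := (h1.rpow_const (p := p) (Or.inl (by positivity))).hasLineDerivAt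
    (EuclideanSpace.single i 1)
  convert! h2 using 1
  simp [EuclideanSpace.inner_single_right]
  ring

lemma hasLineDerivAt_newtonKernel (c : ℝ) (r x : E3) (i : Fin 3) :
    HasLineDerivAt ℝ (newtonKernel c r) (newtonKernelPartial c r i x) x
      (EuclideanSpace.single i 1) := by
  have h : HasLineDerivAt ℝ (newtonKernel c r) _ x (EuclideanSpace.single i 1) :=
    HasDerivAt.const_mul c (hasLineDerivAt_one_add_rpow c (-(1 / 2)) r x i)
  convert! h using 1
  rw [newtonKernelPartial]
  norm_num
  ring

lemma hasLineDerivAt_newtonKernelPartial (c : ℝ) (r x : E3) (i : Fin 3) :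
    HasLineDerivAt ℝ (newtonKernelPartial c r i) (newtonKernelPartialTwo c r i x) x
      (EuclideanSpace.single i 1) := by
  have h1 : HasLineDerivAt ℝ (fun x : E3 => (x - r) i) 1 x (EuclideanSpace.single i 1) := by
    have := ((EuclideanSpace.proj i : E3 →L[ℝ] ℝ).hasFDerivAt.comp x
      ((hasFDerivAt_id x).sub_const r)).hasLineDerivAt (EuclideanSpace.single i 1)
    convert! this using 1
    simp
  have h2 : HasLineDerivAt ℝ (newtonKernelPartial c r i) _ x (EuclideanSpace.single i 1) :=
    HasDerivAt.const_mul (-c ^ 3)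
      (HasDerivAt.mul h1 (hasLineDerivAt_one_add_rpow c (-(3 / 2)) r x i))
  convert! h2 using 1
  rw [newtonKernelPartialTwo, zero_smul, add_zero,
    show (-(3 / 2) - 1 : ℝ) = -(5 / 2) by norm_num]
  ring

lemma sum_newtonKernelPartialTwo (c : ℝ) (r x : E3) :
    ∑ i, newtonKernelPartialTwo c r i x
      = -(4 * π) * (c ^ Module.finrank ℝ E3 * newtonBump (c • (r - x))) := by
  have hpos : 0 < 1 + c ^ 2 * ‖x - r‖ ^ 2 := by positivity
  have e : (1 + c ^ 2 * ‖x - r‖ ^ 2) ^ (-(3 / 2) : ℝ)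
      = (1 + c ^ 2 * ‖x - r‖ ^ 2) ^ (-(5 / 2) : ℝ) * (1 + c ^ 2 * ‖x - r‖ ^ 2) := by
    rw [← rpow_add_one hpos.ne']; norm_num
  have hn : ‖c • (r - x)‖ ^ 2 = c ^ 2 * ‖x - r‖ ^ 2 := by
    rw [norm_smul, mul_pow, norm_sub_rev, Real.norm_eq_abs, sq_abs]
  simp only [newtonKernelPartialTwo, newtonBump, finrank_euclideanSpace, Fintype.card_fin, hn, e]
  set A := (1 + c ^ 2 * ‖x - r‖ ^ 2) ^ (-(5 / 2) : ℝ)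
  rw [EuclideanSpace.real_norm_sq_eq, Fin.sum_univ_three, Fin.sum_univ_three]
  field_simp
  ring

lemma continuous_one_add_rpow (c p : ℝ) (r : E3) :
    Continuous fun x : E3 => (1 + c ^ 2 * ‖x - r‖ ^ 2) ^ p :=
  Continuous.rpow_const (by fun_prop) fun x => Or.inl (by positivity)

lemma continuous_newtonKernel (c : ℝ) (r : E3) : Continuous (newtonKernel c r) :=
  (continuous_one_add_rpow c _ r).const_mul c

lemma continuous_newtonKernelPartial (c : ℝ) (r : E3) (i : Fin 3) :
    Continuous (newtonKernelPartial c r i) := by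
  have := continuous_one_add_rpow c (-(3 / 2)) r
  unfold newtonKernelPartial
  fun_prop

lemma continuous_newtonKernelPartialTwo (c : ℝ) (r : E3) (i : Fin 3) :
    Continuous (newtonKernelPartialTwo c r i) := by
  have := continuous_one_add_rpow c (-(3 / 2)) r
  have := continuous_one_add_rpow c (-(5 / 2)) r
  unfold newtonKernelPartialTwo
  fun_prop

lemma abs_newtonKernel_le {c : ℝ} (hc : 0 < c) {r x : E3} (hx : x ≠ r) :
    |newtonKernel c r x| ≤ ‖x - r‖⁻¹ := by
  have hpos : 0 < ‖x - r‖ := norm_pos_iff.2 (sub_ne_zero.2 hx)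
  have e : (c ^ 2 * ‖x - r‖ ^ 2) ^ (-(1 / 2) : ℝ) = c⁻¹ * ‖x - r‖⁻¹ := by
    rw [← mul_pow, rpow_neg (by positivity), ← sqrt_eq_rpow, sqrt_sq (by positivity), mul_inv]
  rw [newtonKernel, abs_of_nonneg (by positivity)]
  calc c * (1 + c ^ 2 * ‖x - r‖ ^ 2) ^ (-(1 / 2) : ℝ)
      ≤ c * (c ^ 2 * ‖x - r‖ ^ 2) ^ (-(1 / 2) : ℝ) :=
        mul_le_mul_of_nonneg_left
          (rpow_le_rpow_of_nonpos (by positivity) (by linarith) (by norm_num)) hc.le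
    _ = ‖x - r‖⁻¹ := by rw [e]; field_simp

lemma tendsto_newtonKernel {r x : E3} (hx : x ≠ r) :
    Filter.Tendsto (fun c => newtonKernel c r x) Filter.atTop (nhds ‖x - r‖⁻¹) := by
  have hpos : 0 < ‖x - r‖ := norm_pos_iff.2 (sub_ne_zero.2 hx)
  have h0 : Filter.Tendsto (fun c : ℝ => (c ^ 2)⁻¹ + ‖x - r‖ ^ 2) Filter.atTop
      (nhds (‖x - r‖ ^ 2)) := by
    simpa using (tendsto_inv_atTop_zero.comp
      (Filter.tendsto_pow_atTop (α := ℝ) two_ne_zero)).add_const (‖x - r‖ ^ 2)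
  have h1 := h0.rpow_const (p := (-(1 / 2) : ℝ)) (Or.inl (by positivity))
  rw [rpow_neg (by positivity), ← sqrt_eq_rpow, sqrt_sq hpos.le] at h1
  refine h1.congr' ?_
  filter_upwards [Filter.eventually_gt_atTop 0] with c hc
  have e : 1 + c ^ 2 * ‖x - r‖ ^ 2 = c ^ 2 * ((c ^ 2)⁻¹ + ‖x - r‖ ^ 2) := by field_simp
  have e2 : (c ^ 2) ^ (-(1 / 2) : ℝ) = c⁻¹ := by
    rw [rpow_neg (by positivity), ← sqrt_eq_rpow, sqrt_sq hc.le]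
  rw [newtonKernel, e, mul_rpow (by positivity) (by positivity), e2]
  field_simp

lemma locallyIntegrable_inv_norm_sub (r : E3) :
    LocallyIntegrable (fun x : E3 => ‖x - r‖⁻¹) := by
  have h0 : ∀ R : ℝ, IntegrableOn (fun x : E3 => ‖x‖⁻¹) (Metric.ball 0 R) := by
    intro R
    rw [integrableOn_fun_norm_addHaar (volume : Measure E3) (f := fun y : ℝ => y⁻¹)]
    have : IntegrableOn (fun y : ℝ => y) (Set.Ioo 0 R) :=
      (continuous_id.integrableOn_Icc (a := 0) (b := R)).mono_set Set.Ioo_subset_Icc_self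
    refine this.congr_fun (fun y hy => ?_) measurableSet_Ioo
    have : y ≠ 0 := hy.1.ne'
    simp only [finrank_euclideanSpace, Fintype.card_fin, smul_eq_mul]
    field_simp
  rw [locallyIntegrable_iff]
  intro K hK
  obtain ⟨R, hR⟩ := hK.isBounded.subset_ball r
  refine IntegrableOn.mono_set ?_ hR
  have := (measurePreserving_sub_right (volume : Measure E3) r).integrableOn_comp_preimage
    (MeasurableEquiv.subRight r).measurableEmbedding (f := fun x : E3 => ‖x‖⁻¹)
    (s := Metric.ball 0 R)
  have hp : (fun x => x - r) ⁻¹' Metric.ball (0 : E3) R = Metric.ball r R := by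
    ext x; simp [dist_eq_norm]
  rw [hp] at this
  exact this.2 (h0 R)

section Laplacian

variable {u : E3 → ℝ}

lemma contDiff_partial (hu : ContDiff ℝ 2 u) (i : Fin 3) :
    ContDiff ℝ 1 fun y => fderiv ℝ u y (EuclideanSpace.single i 1) :=
  (hu.fderiv_right (m := 1) (by norm_num)).clm_apply contDiff_const

lemma continuous_lap (hu : ContDiff ℝ 2 u) : Continuous (lap u) :=
  continuous_finsetSum _ fun i _ =>
    ((contDiff_partial hu i).continuous_fderiv (by norm_num)).clm_apply continuous_const

lemma hasCompactSupport_lap (hs : HasCompactSupport u) : HasCompactSupport (lap u) := by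
  refine hs.mono' fun x hx => ?_
  contrapose! hx
  simp only [Function.mem_support, not_not, lap]
  refine Finset.sum_eq_zero fun i _ => ?_
  have h : ∀ᶠ y in nhds x, fderiv ℝ u y (EuclideanSpace.single i 1) = 0 := by
    filter_upwards [(isClosed_tsupport u).isOpen_compl.mem_nhds hx] with y hy
    rw [fderiv_of_notMem_tsupport ℝ hy]
    rfl
  rw [Filter.EventuallyEq.fderiv_eq (f := fun _ => (0 : ℝ)) h]
  simp

/-- Green's second identity against the regularized Newtonian kernel. -/
lemma integral_lap_mul_newtonKernel (hu : ContDiff ℝ 2 u) (hs : HasCompactSupport u) (c : ℝ)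
    (r : E3) :
    ∫ x, newtonKernel c r x * lap u x
      = -(4 * π) * ∫ x, (c ^ Module.finrank ℝ E3 * newtonBump (c • (r - x))) • u x := by
  set e : Fin 3 → E3 := fun i => EuclideanSpace.single i 1
  set v : Fin 3 → E3 → ℝ := fun i y => fderiv ℝ u y (e i)
  have hv : ∀ i, ContDiff ℝ 1 (v i) := contDiff_partial hu
  have hvs : ∀ i, HasCompactSupport (v i) := fun i => hs.fderiv_apply (𝕜 := ℝ) (e i)
  have hw : ∀ i, Continuous fun x => fderiv ℝ (v i) x (e i) := fun i =>
    ((hv i).continuous_fderiv (by norm_num)).clm_apply continuous_const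
  have hws : ∀ i, HasCompactSupport fun x => fderiv ℝ (v i) x (e i) := fun i =>
    (hvs i).fderiv_apply (𝕜 := ℝ) (e i)
  have int_mul {f g : E3 → ℝ} (hf : Continuous f) (hg : Continuous g)
      (hgs : HasCompactSupport g) : Integrable (fun x => f x * g x) :=
    (hf.mul hg).integrable_of_hasCompactSupport hgs.mul_left
  have hparts (i : Fin 3) : ∫ x, newtonKernel c r x * fderiv ℝ (v i) x (e i)
      = ∫ x, newtonKernelPartialTwo c r i x * u x := by
    have h1 := integral_bilinear_hasLineDerivAt_right_eq_neg_left_of_integrable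
      (μ := (volume : Measure E3)) (B := ContinuousLinearMap.mul ℝ ℝ) (v := e i)
      (int_mul (continuous_newtonKernelPartial c r i) (hv i).continuous (hvs i))
      (int_mul (continuous_newtonKernel c r) (hw i) (hws i))
      (int_mul (continuous_newtonKernel c r) (hv i).continuous (hvs i))
      (fun x _ => hasLineDerivAt_newtonKernel c r x i)
      (fun x _ => (((hv i).differentiable (by norm_num)) x).hasFDerivAt.hasLineDerivAt (e i))
    have h2 := integral_bilinear_hasLineDerivAt_right_eq_neg_left_of_integrable
      (μ := (volume : Measure E3)) (B := ContinuousLinearMap.mul ℝ ℝ) (v := e i)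
      (int_mul (continuous_newtonKernelPartialTwo c r i) hu.continuous hs)
      (int_mul (continuous_newtonKernelPartial c r i) (hv i).continuous (hvs i))
      (int_mul (continuous_newtonKernelPartial c r i) hu.continuous hs)
      (fun x _ => hasLineDerivAt_newtonKernelPartial c r x i)
      (fun x _ => ((hu.differentiable (by norm_num)) x).hasFDerivAt.hasLineDerivAt (e i))
    simp only [ContinuousLinearMap.mul_apply'] at h1 h2
    rw [h1, h2, neg_neg]
  calc ∫ x, newtonKernel c r x * lap u x
      = ∫ x, ∑ i, newtonKernel c r x * fderiv ℝ (v i) x (e i) := by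
        simp only [lap, Finset.mul_sum, v, e]
    _ = ∑ i, ∫ x, newtonKernelPartialTwo c r i x * u x := by
        rw [integral_finsetSum _ fun i _ => int_mul (continuous_newtonKernel c r) (hw i) (hws i)]
        exact Finset.sum_congr rfl fun i _ => hparts i
    _ = ∫ x, ∑ i, newtonKernelPartialTwo c r i x * u x :=
        (integral_finsetSum _ fun i _ =>
          int_mul (continuous_newtonKernelPartialTwo c r i) hu.continuous hs).symm
    _ = _ := by
        rw [← integral_const_mul]
        simp only [← Finset.sum_mul, sum_newtonKernelPartialTwo, smul_eq_mul, mul_assoc]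

lemma tendsto_integral_lap_mul_newtonKernel (hu : ContDiff ℝ 2 u) (hs : HasCompactSupport u)
    (r : E3) :
    Filter.Tendsto (fun c => ∫ x, newtonKernel c r x * lap u x) Filter.atTop
      (nhds (∫ x, lap u x / ‖r - x‖)) := by
  have hne : ∀ᵐ x : E3, x ≠ r := Measure.ae_ne volume r
  have hbound : Integrable fun x : E3 => ‖x - r‖⁻¹ * |lap u x| :=
    (locallyIntegrable_inv_norm_sub r).integrable_smul_right_of_hasCompactSupport
      (continuous_lap hu).abs (hasCompactSupport_lap hs).abs
  refine tendsto_integral_filter_of_dominated_convergence _ ?_ ?_ hbound ?_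
  · exact .of_forall fun c =>
      ((continuous_newtonKernel c r).mul (continuous_lap hu)).aestronglyMeasurable
  · filter_upwards [Filter.eventually_gt_atTop 0] with c hc
    filter_upwards [hne] with x hx
    rw [norm_mul, Real.norm_eq_abs, Real.norm_eq_abs]
    exact mul_le_mul_of_nonneg_right (abs_newtonKernel_le hc hx) (abs_nonneg _)
  · filter_upwards [hne] with x hx
    rw [div_eq_inv_mul, norm_sub_rev]
    exact (tendsto_newtonKernel hx).mul_const _

end Laplacian

/-- a C² compactly supported function is recovered from its Laplacian:
u(r) = −(1/4π)∫ Δu(r')/‖r−r'‖ dr'. -/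
theorem recover_from_laplacian (u : E3 → ℝ)
    (hu : ContDiff ℝ 2 u) (hu_supp : HasCompactSupport u) (r : E3) :
    u r = -(1 / (4 * π)) * ∫ r' : E3, lap u r' / ‖r - r'‖ := by
  have h := tendsto_integral_lap_mul_newtonKernel hu hu_supp r
  simp only [integral_lap_mul_newtonKernel hu hu_supp] at h
  have h' := (tendsto_integral_comp_smul_smul_of_integrable' newtonBump_nonneg integral_newtonBump
    tendsto_norm_pow_mul_newtonBump (hu.continuous.integrable_of_hasCompactSupport hu_supp)
    (hu.continuous.continuousAt (x := r))).const_mul (-(4 * π))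
  rw [tendsto_nhds_unique h h']
  field_simp

end
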